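/- arXiv:1912.00002 — 2 statements merged into one kernel-verified Lean document; each statement's English description precedes it below -/
import Mathlib

section
/- Let a ∈ (0,1) and let P : (1−a, 1+a) → ℝ be five times differentiable with P(1) = 0, P′(1) = 2, P″(1) = 2, P‴(1) = −2, P⁗(1) = 4, and P⁽⁵⁾(1) ∈ (−12, −8). Then there exists a real number η ∈ (0, a] such that 2t·ln t ≤ P(t) ≤ f(t²−1) for all t ∈ [1, 1+η] and 2t·ln t ≥ P(t) ≥ f(t²−1) for all t ∈ [1−η, 1]. -/
open Real Set

noncomputable def f (x : ℝ) : ℝ :=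
  π + (1 / 2) * (4 + π) * x - 2 * (x + 2) * Real.arctan (Real.sqrt (x + 1))

open Filter Topology

/-- Integrating the sign of a derivative: if `(t - x) ^ n * G' t ≥ 0` near `x` and `G x = 0`,
then `(t - x) ^ (n + 1) * G t ≥ 0` near `x`. -/
lemma eventually_nonneg_pow_succ_mul {G G' : ℝ → ℝ} {x : ℝ} {n : ℕ}
    (hG : ∀ᶠ t in 𝓝 x, HasDerivAt G (G' t) t) (hx : G x = 0)
    (hsign : ∀ᶠ t in 𝓝 x, 0 ≤ (t - x) ^ n * G' t) :
    ∀ᶠ t in 𝓝 x, 0 ≤ (t - x) ^ (n + 1) * G t := by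
  obtain ⟨ε, hε, hball⟩ := Metric.eventually_nhds_iff_ball.1 (hG.and hsign)
  refine Metric.eventually_nhds_iff_ball.2 ⟨ε, hε, fun t ht => ?_⟩
  rw [Real.ball_eq_Ioo] at hball ht
  have key : ∀ ξ r : ℝ, ξ ∈ Ioo (x - ε) (x + ε) → 0 ≤ r → t - x = r * (ξ - x) →
      G t = G' ξ * (t - x) → 0 ≤ (t - x) ^ (n + 1) * G t := by
    intro ξ r hξ hr hrt hGt
    have h := mul_nonneg (mul_nonneg (sq_nonneg (t - x)) (pow_nonneg hr n)) (hball ξ hξ).2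
    calc 0 ≤ (t - x) ^ 2 * r ^ n * ((ξ - x) ^ n * G' ξ) := h
      _ = (r * (ξ - x)) ^ n * (t - x) * (G' ξ * (t - x)) := by rw [mul_pow]; ring
      _ = (t - x) ^ (n + 1) * G t := by rw [← hrt, ← hGt]; ring
  rcases lt_trichotomy t x with h | h | h
  · have hd : ∀ s ∈ Icc t x, HasDerivAt G (G' s) s := fun s hs =>
      (hball s ⟨by linarith [hs.1, ht.1], by linarith [hs.2]⟩).1
    obtain ⟨ξ, hξ, he⟩ := exists_hasDerivAt_eq_slope G G' h
      (fun s hs => (hd s hs).continuousAt.continuousWithinAt)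
      (fun s hs => hd s (Ioo_subset_Icc_self hs))
    have hne : x - t ≠ 0 := by linarith
    have hne' : ξ - x ≠ 0 := by linarith [hξ.2]
    refine key ξ ((t - x) / (ξ - x)) ⟨by linarith [hξ.1, ht.1], by linarith [hξ.2]⟩
      (div_nonneg_of_nonpos (by linarith) (by linarith [hξ.2])) (by field_simp) ?_
    rw [he, hx]
    field_simp
    ring
  · simp [h]
  · have hd : ∀ s ∈ Icc x t, HasDerivAt G (G' s) s := fun s hs =>
      (hball s ⟨by linarith [hs.1], by linarith [hs.2, ht.2]⟩).1
    obtain ⟨ξ, hξ, he⟩ := exists_hasDerivAt_eq_slope G G' h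
      (fun s hs => (hd s hs).continuousAt.continuousWithinAt)
      (fun s hs => hd s (Ioo_subset_Icc_self hs))
    have hne : t - x ≠ 0 := by linarith
    have hne' : ξ - x ≠ 0 := by linarith [hξ.1]
    refine key ξ ((t - x) / (ξ - x)) ⟨by linarith [hξ.1], by linarith [hξ.2, ht.2]⟩
      (div_nonneg (by linarith) (by linarith [hξ.1])) (by field_simp) ?_
    rw [he, hx]
    field_simp
    ring

/-- A function whose first nonvanishing derivative at `x` is the `(n + 1)`-st one, and is positive,
has the sign of `(t - x) ^ (n + 1)` near `x`. Here `D j` is the `j`-th derivative. -/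
lemma eventually_nonneg_of_first_deriv_pos {D : ℕ → ℝ → ℝ} {x c : ℝ} {n : ℕ}
    (hD : ∀ j < n, ∀ᶠ t in 𝓝 x, HasDerivAt (D j) (D (j + 1) t) t)
    (hx : ∀ j ≤ n, D j x = 0) (hn : HasDerivAt (D n) c x) (hc : 0 < c) :
    ∀ᶠ t in 𝓝 x, 0 ≤ (t - x) ^ (n + 1) * D 0 t := by
  induction n generalizing D with
  | zero =>
    have h := (hasDerivAt_iff_tendsto_slope.1 hn).eventually_const_lt hc
    filter_upwards [eventually_nhdsWithin_iff.1 h] with t ht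
    rcases eq_or_ne t x with rfl | hne
    · simp
    · have hs := ht hne
      rw [slope_def_field, hx 0 le_rfl, sub_zero] at hs
      have hne' : t - x ≠ 0 := sub_ne_zero.2 hne
      calc 0 ≤ (t - x) ^ 2 * (D 0 t / (t - x)) := by positivity
        _ = (t - x) ^ (0 + 1) * D 0 t := by field_simp; ring
  | succ n ih =>
    exact eventually_nonneg_pow_succ_mul (hD 0 n.succ_pos) (hx 0 (Nat.zero_le _))
      (ih (D := fun j => D (j + 1)) (fun j hj => hD (j + 1) (by omega))
        (fun j hj => hx (j + 1) (by omega)) hn)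

/-- Local comparison of two functions whose derivatives (`u j` and `v j`) agree at `x` up to
order `n`, the derivatives of order `n + 1` being strictly ordered. -/
lemma eventually_nonneg_sub_of_deriv_lt {u v : ℕ → ℝ → ℝ} {x b c : ℝ} {n : ℕ}
    (hu : ∀ j < n, ∀ᶠ t in 𝓝 x, HasDerivAt (u j) (u (j + 1) t) t)
    (hv : ∀ j < n, ∀ᶠ t in 𝓝 x, HasDerivAt (v j) (v (j + 1) t) t)
    (hx : ∀ j ≤ n, u j x = v j x)
    (hun : HasDerivAt (u n) b x) (hvn : HasDerivAt (v n) c x) (hbc : b < c) :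
    ∀ᶠ t in 𝓝 x, 0 ≤ (t - x) ^ (n + 1) * (v 0 t - u 0 t) :=
  eventually_nonneg_of_first_deriv_pos (D := fun j t => v j t - u j t)
    (fun j hj => by
      filter_upwards [hu j hj, hv j hj] with t h h' using h'.sub h)
    (fun j hj => sub_eq_zero.2 (hx j hj).symm) (hvn.sub hun) (sub_pos.2 hbc)

/-- The derivatives of `t ↦ 2 * t * log t` on the positive reals, up to order four. -/
noncomputable def mulLogDeriv : ℕ → ℝ → ℝ
  | 0 => fun t => 2 * t * Real.log t
  | 1 => fun t => 2 * Real.log t + 2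
  | 2 => fun t => 2 / t
  | 3 => fun t => -2 / t ^ 2
  | _ => fun t => 4 / t ^ 3

lemma hasDerivAt_mulLogDeriv {t : ℝ} (ht : 0 < t) :
    ∀ j < 4, HasDerivAt (mulLogDeriv j) (mulLogDeriv (j + 1) t) t := by
  have hid := hasDerivAt_id' t
  have hlog := Real.hasDerivAt_log ht.ne'
  intro j hj
  interval_cases j
  · exact ((hid.const_mul 2).mul hlog).congr_deriv (by simp only [mulLogDeriv]; field_simp)
  · exact ((hlog.const_mul 2).add_const 2).congr_deriv (by simp only [mulLogDeriv]; field_simp)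
  · exact ((hasDerivAt_const t (2 : ℝ)).div hid ht.ne').congr_deriv
      (by simp only [mulLogDeriv]; field_simp; ring)
  · exact ((hasDerivAt_const t (-2 : ℝ)).div (hid.pow 2) (pow_ne_zero 2 ht.ne')).congr_deriv
      (by simp only [mulLogDeriv, Nat.cast_ofNat, Pi.pow_apply]; field_simp; ring)

lemma hasDerivAt_mulLogDeriv_four_one : HasDerivAt (mulLogDeriv 4) (-12) 1 :=
  ((hasDerivAt_const (1 : ℝ) (4 : ℝ)).div ((hasDerivAt_id' (1 : ℝ)).pow 3)
    (by norm_num)).congr_deriv (by norm_num)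

/-- The derivatives of `t ↦ f (t ^ 2 - 1)` on the nonnegative reals, up to order four. -/
noncomputable def arctanBoundDeriv : ℕ → ℝ → ℝ
  | 0 => fun t => π + (1 / 2) * (4 + π) * (t ^ 2 - 1) - 2 * (t ^ 2 + 1) * Real.arctan t
  | 1 => fun t => (4 + π) * t - 4 * t * Real.arctan t - 2
  | 2 => fun t => 4 + π - 4 * Real.arctan t - 4 * t / (1 + t ^ 2)
  | 3 => fun t => -8 / (1 + t ^ 2) ^ 2
  | _ => fun t => 32 * t / (1 + t ^ 2) ^ 3

lemma f_sq_sub_one {t : ℝ} (ht : 0 ≤ t) : f (t ^ 2 - 1) = arctanBoundDeriv 0 t := by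
  simp only [f, arctanBoundDeriv, sub_add_cancel, Real.sqrt_sq ht]
  ring

lemma hasDerivAt_arctanBoundDeriv (t : ℝ) :
    ∀ j < 4, HasDerivAt (arctanBoundDeriv j) (arctanBoundDeriv (j + 1) t) t := by
  have hid := hasDerivAt_id' t
  have hat := Real.hasDerivAt_arctan t
  have hsq : HasDerivAt (fun s : ℝ => 1 + s ^ 2) (2 * t) t := by
    simpa using (hid.pow 2).const_add 1
  have hne : 1 + t ^ 2 ≠ 0 := by positivity
  intro j hj
  interval_cases j
  · refine (((((hid.pow 2).sub_const 1).const_mul ((1 / 2) * (4 + π))).const_add π).sub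
      ((((hid.pow 2).add_const 1).const_mul 2).mul hat)).congr_deriv ?_
    simp only [arctanBoundDeriv, Nat.cast_ofNat, Pi.pow_apply]
    field_simp
    ring
  · refine (((hid.const_mul (4 + π)).sub ((hid.const_mul 4).mul hat)).sub_const 2).congr_deriv ?_
    simp only [arctanBoundDeriv]
    field_simp
    ring
  · refine (((hat.const_mul 4).const_sub (4 + π)).sub
      ((hid.const_mul 4).div hsq hne)).congr_deriv ?_
    simp only [arctanBoundDeriv]
    field_simp
    ring
  · refine ((hasDerivAt_const t (-8 : ℝ)).div (hsq.pow 2) (pow_ne_zero 2 hne)).congr_deriv ?_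
    simp only [arctanBoundDeriv, Nat.cast_ofNat, Pi.pow_apply]
    field_simp
    ring

lemma hasDerivAt_arctanBoundDeriv_four_one : HasDerivAt (arctanBoundDeriv 4) (-8) 1 := by
  have hid := hasDerivAt_id' (1 : ℝ)
  exact ((hid.const_mul 32).div (((hid.pow 2).const_add 1).pow 3) (by norm_num)).congr_deriv
    (by norm_num)

theorem local_bounds_fifth_derivative (a : ℝ) (ha : a ∈ Set.Ioo (0 : ℝ) 1) (P : ℝ → ℝ)
    (hdiff : ∀ j < 5, DifferentiableOn ℝ (iteratedDeriv j P) (Set.Ioo (1 - a) (1 + a)))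
    (hP0 : P 1 = 0) (hP1 : deriv P 1 = 2) (hP2 : iteratedDeriv 2 P 1 = 2)
    (hP3 : iteratedDeriv 3 P 1 = -2) (hP4 : iteratedDeriv 4 P 1 = 4)
    (hP5 : iteratedDeriv 5 P 1 ∈ Set.Ioo (-12 : ℝ) (-8)) :
    ∃ η ∈ Set.Ioc (0 : ℝ) a,
      (∀ t ∈ Set.Icc (1 : ℝ) (1 + η),
        2 * t * Real.log t ≤ P t ∧ P t ≤ f (t ^ 2 - 1)) ∧
      (∀ t ∈ Set.Icc (1 - η) (1 : ℝ),
        2 * t * Real.log t ≥ P t ∧ P t ≥ f (t ^ 2 - 1)) := by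
  have hmem : Ioo (1 - a) (1 + a) ∈ 𝓝 (1 : ℝ) :=
    Ioo_mem_nhds (by linarith [ha.1]) (by linarith [ha.1])
  have hP : ∀ j < 5, ∀ t ∈ Ioo (1 - a) (1 + a),
      HasDerivAt (iteratedDeriv j P) (iteratedDeriv (j + 1) P t) t := fun j hj t ht => by
    rw [iteratedDeriv_succ]
    exact ((hdiff j hj).differentiableAt (isOpen_Ioo.mem_nhds ht)).hasDerivAt
  have hPev : ∀ j < 4, ∀ᶠ t in 𝓝 (1 : ℝ),
      HasDerivAt (iteratedDeriv j P) (iteratedDeriv (j + 1) P t) t := fun j hj => by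
    filter_upwards [hmem] with t ht using hP j (by omega) t ht
  have hP5' := hP 4 (by norm_num) 1 (mem_of_mem_nhds hmem)
  have hpos : ∀ᶠ t in 𝓝 (1 : ℝ), 0 < t := lt_mem_nhds one_pos
  have hlower := eventually_nonneg_sub_of_deriv_lt (u := mulLogDeriv)
    (v := fun j => iteratedDeriv j P)
    (fun j hj => hpos.mono fun t ht => hasDerivAt_mulLogDeriv ht j hj) hPev
    (fun j hj => by
      interval_cases j <;> simp [mulLogDeriv, iteratedDeriv_one, *])
    hasDerivAt_mulLogDeriv_four_one hP5' hP5.1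
  have hupper := eventually_nonneg_sub_of_deriv_lt (u := fun j => iteratedDeriv j P)
    (v := arctanBoundDeriv) hPev
    (fun j hj => Eventually.of_forall fun t => hasDerivAt_arctanBoundDeriv t j hj)
    (fun j hj => by
      interval_cases j <;>
        simp only [arctanBoundDeriv, iteratedDeriv_zero, iteratedDeriv_one, Real.arctan_one, *] <;>
        ring)
    hP5' hasDerivAt_arctanBoundDeriv_four_one hP5.2
  obtain ⟨ε, hε, hball⟩ := Metric.eventually_nhds_iff_ball.1 (hpos.and (hlower.and hupper))
  rw [Real.ball_eq_Ioo] at hball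
  have hη : 0 < min a (ε / 2) := lt_min ha.1 (half_pos hε)
  have hηε : min a (ε / 2) < ε := (min_le_right _ _).trans_lt (half_lt_self hε)
  have hodd : Odd (4 + 1) := by decide
  refine ⟨min a (ε / 2), ⟨hη, min_le_left _ _⟩, fun t ht => ?_, fun t ht => ?_⟩
  · obtain ⟨h0, hl, hu⟩ := hball t ⟨by linarith [ht.1], by linarith [ht.2]⟩
    rcases ht.1.eq_or_lt with rfl | h1
    · norm_num [f, hP0]
      ring_nf
      simp
    · have hp : 0 < (t - 1) ^ (4 + 1) := pow_pos (sub_pos.2 h1) _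
      rw [f_sq_sub_one h0.le]
      exact ⟨sub_nonneg.1 (nonneg_of_mul_nonneg_right hl hp),
        sub_nonneg.1 (nonneg_of_mul_nonneg_right hu hp)⟩
  · obtain ⟨h0, hl, hu⟩ := hball t ⟨by linarith [ht.1], by linarith [ht.2]⟩
    rcases ht.2.eq_or_lt with rfl | h1
    · norm_num [f, hP0]
      ring_nf
      simp
    · have hp : (t - 1) ^ (4 + 1) < 0 := hodd.pow_neg (sub_neg.2 h1)
      rw [f_sq_sub_one h0.le]
      exact ⟨sub_nonpos.1 (nonpos_of_mul_nonneg_right hl hp),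
        sub_nonpos.1 (nonpos_of_mul_nonneg_right hu hp)⟩
end

section
/- For every real number x ≥ 0, one has ln(1+x) ≤ (x+2)·[(x+1)³ − 1] / (3(1+x)·[(x+1)² + 1]). -/
theorem hasDerivAt_rational_sub_log {t : ℝ} (ht : 0 < t) :
    HasDerivAt (fun s : ℝ => (s + 1) * (s ^ 3 - 1) / (3 * s * (s ^ 2 + 1)) - Real.log s)
      ((t - 1) ^ 4 * (t ^ 2 + t + 1) / (3 * t ^ 2 * (t ^ 2 + 1) ^ 2)) t := by
  have hid := hasDerivAt_id' t
  have hnum := (hid.add_const 1).fun_mul ((hid.fun_pow 3).sub_const 1)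
  have hden := (hid.const_mul 3).fun_mul ((hid.fun_pow 2).add_const 1)
  have hne : 3 * t * (t ^ 2 + 1) ≠ 0 := by positivity
  refine ((hnum.fun_div hden hne).fun_sub (Real.hasDerivAt_log ht.ne')).congr_deriv ?_
  field_simp
  push_cast
  ring

theorem monotoneOn_rational_sub_log :
    MonotoneOn (fun s : ℝ => (s + 1) * (s ^ 3 - 1) / (3 * s * (s ^ 2 + 1)) - Real.log s)
      (Set.Ioi 0) := by
  refine monotoneOn_of_hasDerivWithinAt_nonneg (convex_Ioi 0)
    (fun t ht => (hasDerivAt_rational_sub_log ht).continuousAt.continuousWithinAt)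
    (fun t ht => (hasDerivAt_rational_sub_log (interior_subset ht)).hasDerivWithinAt)
    (fun t ht => ?_)
  have ht' : 0 < t := interior_subset ht
  positivity

theorem log_le_rational_three (x : ℝ) (hx : 0 ≤ x) :
    Real.log (1 + x) ≤ (x + 2) * ((x + 1) ^ 3 - 1) / (3 * (1 + x) * ((x + 1) ^ 2 + 1)) := by
  have h := monotoneOn_rational_sub_log (Set.mem_Ioi.2 one_pos)
    (Set.mem_Ioi.2 (by positivity : 0 < x + 1)) (by linarith)
  norm_num [add_assoc] at h
  rwa [add_comm 1 x]
end
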